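/- Let q = 2^a with a ≥ 1, K = 𝔽_q((u)), O = 𝔽_q[[u]], and let P₁, P₂ and B = P₁ ∩ P₂ be the standard parahoric and Iwahori subgroups of SL₂(K). Suppose A₁ ≤ P₁ and A₂ ≤ P₂ are finite subgroups such that, for i = 1,2: every element of P_i can be written as a·b with a ∈ A_i and b ∈ B, and A_i ∩ P_{3-i} = A₁ ∩ A₂. Then A₁ ∩ A₂ is the trivial subgroup and each A_i is cyclic of order q+1. -/

import Mathlib

/-- The valuation ring `O = 𝔽_q[[u]]` of `K = 𝔽_q((u))`, regarded as a subring of `K`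
(the image of the ring of formal power series). -/
noncomputable def laurentIntegers (F : Type*) [Field F] : Subring (LaurentSeries F) :=
  (HahnSeries.ofPowerSeries ℤ F).range

/-- The uniformiser `u` of `K = 𝔽_q((u))`. -/
noncomputable def laurentVar (F : Type*) [Field F] : LaurentSeries F :=
  HahnSeries.ofPowerSeries ℤ F PowerSeries.X

/-- The standard parahoric subgroup `P₁` of `SL₂(K)`: matrices all of whose entries lie
in `O`. -/
def parahoricOne (F : Type*) [Field F] :
    Set (Matrix.SpecialLinearGroup (Fin 2) (LaurentSeries F)) :=
  {g | ∀ i j : Fin 2, (↑g : Matrix (Fin 2) (Fin 2) (LaurentSeries F)) i j ∈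
    laurentIntegers F}

/-- The standard parahoric subgroup `P₂` of `SL₂(K)`: matrices whose diagonal entries lie
in `O`, with `u` times the top-right entry in `O`, and bottom-left entry in `u·O`. -/
def parahoricTwo (F : Type*) [Field F] :
    Set (Matrix.SpecialLinearGroup (Fin 2) (LaurentSeries F)) :=
  {g | (↑g : Matrix (Fin 2) (Fin 2) (LaurentSeries F)) 0 0 ∈ laurentIntegers F ∧
       (↑g : Matrix (Fin 2) (Fin 2) (LaurentSeries F)) 1 1 ∈ laurentIntegers F ∧
       laurentVar F * (↑g : Matrix (Fin 2) (Fin 2) (LaurentSeries F)) 0 1 ∈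
         laurentIntegers F ∧
       ∃ y ∈ laurentIntegers F,
         (↑g : Matrix (Fin 2) (Fin 2) (LaurentSeries F)) 1 0 = laurentVar F * y}

/-- The Iwahori subgroup `B = P₁ ∩ P₂`. -/
def iwahori (F : Type*) [Field F] :
    Set (Matrix.SpecialLinearGroup (Fin 2) (LaurentSeries F)) :=
  parahoricOne F ∩ parahoricTwo F

open Matrix in
lemma exists_smul_eq_of_mulVec_eq_zero {k : Type*} [Field k] {Y : Matrix (Fin 2) (Fin 2) k}
    (hY : Y ≠ 0) {v w : Fin 2 → k} (hv : v ≠ 0) (hYv : Y *ᵥ v = 0) (hYw : Y *ᵥ w = 0) :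
    ∃ c : k, w = c • v := by
  have hdet : w 0 * v 1 = w 1 * v 0 := by
    by_contra hne
    refine hY ?_
    have hd : w 0 * v 1 - w 1 * v 0 ≠ 0 := sub_ne_zero.2 hne
    have hv' := fun i => congrFun hYv i
    have hw' := fun i => congrFun hYw i
    simp only [mulVec, dotProduct, Fin.sum_univ_two, Pi.zero_apply] at hv' hw'
    ext i j
    have h0 : Y i 0 * (w 0 * v 1 - w 1 * v 0) = 0 := by
      linear_combination v 1 * hw' i - w 1 * hv' i
    have h1 : Y i 1 * (w 0 * v 1 - w 1 * v 0) = 0 := by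
      linear_combination w 0 * hv' i - v 0 * hw' i
    fin_cases j
    · simpa [hd] using h0
    · simpa [hd] using h1
  by_cases h0 : v 0 = 0
  · have h1 : v 1 ≠ 0 := fun h1 => hv (by ext i; fin_cases i <;> simp [h0, h1])
    refine ⟨w 1 / v 1, ?_⟩
    ext i
    fin_cases i
    · simpa [h0, h1] using hdet
    · simp [h1]
  · refine ⟨w 0 / v 0, ?_⟩
    ext i
    fin_cases i
    · simp [h0]
    · simp [field]; linear_combination -hdet

lemma eq_one_of_sq_eq_one_of_odd {G : Type*} [Group G] [Finite G] (hodd : Odd (Nat.card G))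
    {x : G} (hx : x ^ 2 = 1) : x = 1 := by
  have h1 := orderOf_dvd_of_pow_eq_one hx
  have h2 := orderOf_dvd_natCard x
  have h3 : orderOf x ∣ 1 := by
    rw [← (Nat.coprime_two_left.2 hodd : Nat.gcd 2 (Nat.card G) = 1)]
    exact Nat.dvd_gcd h1 h2
  exact orderOf_eq_one_iff.1 (Nat.dvd_one.1 h3)

namespace Matrix.SpecialLinearGroup

lemma map_injective_of_injective {n R S : Type*} [DecidableEq n] [Fintype n] [CommRing R]
    [CommRing S] {f : R →+* S} (hf : Function.Injective f) :
    Function.Injective (map f : SpecialLinearGroup n R →* SpecialLinearGroup n S) :=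
  fun x y hxy => ext x y fun i j => hf (congrFun (congrFun (congrArg Subtype.val hxy) i) j)

lemma sq_eq_one_of_trace_eq_zero {k : Type*} [CommRing k] [CharP k 2]
    {g : SpecialLinearGroup (Fin 2) k} (h : g 0 0 + g 1 1 = 0) : g ^ 2 = 1 := by
  have hdet := g.det_coe
  rw [Matrix.det_fin_two] at hdet
  have h2 : (2 : k) = 0 := CharTwo.two_eq_zero
  ext i j
  rw [pow_two]
  fin_cases i <;> fin_cases j <;> simp [Matrix.mul_apply, Fin.sum_univ_two]
  · linear_combination -hdet + g 0 0 * h - h2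
  · linear_combination g 0 1 * h
  · linear_combination g 1 0 * h
  · linear_combination -hdet + g 1 1 * h - h2

lemma trace_eq_zero_of_sq_eq_one {k : Type*} [CommRing k] [IsDomain k] [CharP k 2]
    {g : SpecialLinearGroup (Fin 2) k} (h : g ^ 2 = 1) : g 0 0 + g 1 1 = 0 := by
  have hdet := g.det_coe
  rw [Matrix.det_fin_two] at hdet
  have h2 : (2 : k) = 0 := CharTwo.two_eq_zero
  have key : ∀ i j, (g ^ 2) i j = (1 : SpecialLinearGroup (Fin 2) k) i j := fun i j => by rw [h]
  have k00 := key 0 0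
  have k11 := key 1 1
  simp [pow_two, Matrix.mul_apply, Fin.sum_univ_two] at k00 k11
  have : (g 0 0 + g 1 1) ^ 2 = 0 := by
    linear_combination k00 + k11 + 2 * hdet + 2 * h2
  exact pow_eq_zero_iff two_ne_zero |>.1 this

lemma sum_conj_mul_comm {k G : Type*} [CommRing k] [Group G] [Fintype G]
    (σ : G →* SpecialLinearGroup (Fin 2) k) (E : Matrix (Fin 2) (Fin 2) k) (h : G) :
    (σ h : Matrix (Fin 2) (Fin 2) k) * (∑ g, (σ g).1 * E * (σ g⁻¹).1) =
      (∑ g, (σ g).1 * E * (σ g⁻¹).1) * (σ h).1 := by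
  rw [Finset.mul_sum, Finset.sum_mul]
  refine Fintype.sum_equiv (Equiv.mulLeft h) _ _ fun g => ?_
  have : (σ g⁻¹).1 = (σ (h * g)⁻¹).1 * (σ h).1 := by
    rw [← coe_mul, ← map_mul]
    simp
  simp only [Equiv.coe_mulLeft, this, map_mul, coe_mul, Matrix.mul_assoc]

lemma sum_trace_sq_eq_zero {k G : Type*} [Field k] [CharP k 2] [Group G] [Fintype G]
    (hodd : Odd (Nat.card G)) (σ : G →* SpecialLinearGroup (Fin 2) k) :
    ∑ g, (σ g 0 0 + σ g 1 1) ^ 2 = 0 := by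
  refine Finset.sum_involution (fun g _ => g⁻¹) (fun g _ => ?_) (fun g _ hg => ?_)
    (fun _ _ => Finset.mem_univ _) (fun _ _ => inv_inv _)
  · have : σ g⁻¹ 0 0 + σ g⁻¹ 1 1 = σ g 0 0 + σ g 1 1 := by
      rw [map_inv, SL2_inv_expl]
      simp [add_comm]
    rw [this, CharTwo.add_self_eq_zero]
  · rintro hinv
    have : g = 1 := eq_one_of_sq_eq_one_of_odd hodd (by rw [pow_two]; nth_rw 1 [← hinv]; simp)
    subst this
    simp [CharTwo.add_self_eq_zero] at hg

lemma exists_commute_not_scalar {k G : Type*} [Field k] [CharP k 2] [Group G] [Finite G]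
    (hodd : Odd (Nat.card G)) (σ : G →* SpecialLinearGroup (Fin 2) k) :
    ∃ X : Matrix (Fin 2) (Fin 2) k, (∀ g, (σ g).1 * X = X * (σ g).1) ∧
      ∀ c : k, X ≠ Matrix.scalar (Fin 2) c := by
  have := Fintype.ofFinite G
  by_contra! hcon
  let π : Matrix (Fin 2) (Fin 2) k → Matrix (Fin 2) (Fin 2) k :=
    fun E => ∑ g, (σ g).1 * E * (σ g⁻¹).1
  choose φ hφ using fun E => hcon (π E) (fun h => sum_conj_mul_comm σ E h)
  have hone : π (Matrix.single 0 0 1) + π (Matrix.single 1 1 1) = 1 := by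
    have h1 : (Matrix.single 0 0 1 + Matrix.single 1 1 1 : Matrix (Fin 2) (Fin 2) k) = 1 := by
      ext i j; fin_cases i <;> fin_cases j <;> simp
    simp only [π]
    rw [← Finset.sum_add_distrib]
    simp_rw [← Matrix.add_mul, ← Matrix.mul_add, h1, Matrix.mul_one, ← coe_mul, ← map_mul,
      mul_inv_cancel, map_one, coe_one]
    rw [Finset.sum_const, Finset.card_univ, ← Nat.card_eq_fintype_card]
    obtain ⟨m, hm⟩ := hodd
    rw [hm, add_smul, mul_smul, two_smul, one_smul]
    simp [← two_smul k, CharTwo.two_eq_zero]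
  have htr : π (Matrix.single 0 0 1) 0 0 + π (Matrix.single 0 1 1) 0 1
      + π (Matrix.single 1 0 1) 1 0 + π (Matrix.single 1 1 1) 1 1 = 0 := by
    rw [← sum_trace_sq_eq_zero hodd σ]
    simp only [π, Matrix.sum_apply]
    simp only [← Finset.sum_add_distrib]
    refine Finset.sum_congr rfl fun g _ => ?_
    rw [map_inv, coe_inv, Matrix.adjugate_fin_two]
    simp [Matrix.mul_apply, Fin.sum_univ_two, Matrix.single_apply]
    ring
  have h0 := congrFun (congrFun hone 0) 0
  rw [hφ, hφ, hφ, hφ] at htr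
  rw [hφ, hφ] at h0
  simp at h0 htr
  rw [htr] at h0
  exact zero_ne_one h0

lemma isCyclic_of_odd_card_of_isAlgClosed {k G : Type*} [Field k] [IsAlgClosed k] [CharP k 2]
    [Group G] [Finite G] (hodd : Odd (Nat.card G)) (σ : G →* SpecialLinearGroup (Fin 2) k)
    (hσ : Function.Injective σ) : IsCyclic G := by
  obtain ⟨X, hX, hXs⟩ := exists_commute_not_scalar hodd σ
  obtain ⟨μ, hμ⟩ := Module.End.exists_eigenvalue (Matrix.toLin' X)
  obtain ⟨v, hv⟩ := hμ.exists_hasEigenvector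
  have hv0 : v ≠ 0 := hv.2
  have hXv : X.mulVec v = μ • v := hv.apply_eq_smul
  have hY : X - Matrix.scalar (Fin 2) μ ≠ 0 := sub_ne_zero.2 (hXs μ)
  have hsc : ∀ w, (X - Matrix.scalar (Fin 2) μ).mulVec w = X.mulVec w - μ • w := fun w => by
    rw [Matrix.sub_mulVec]
    congr 1
    ext i
    simp [Matrix.mulVec_diagonal]
  have hχ : ∀ g, ∃ c : k, (σ g).1.mulVec v = c • v := fun g => by
    refine exists_smul_eq_of_mulVec_eq_zero hY hv0 ?_ ?_
    · rw [hsc, hXv, sub_self]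
    · rw [hsc, Matrix.mulVec_mulVec, ← hX, ← Matrix.mulVec_mulVec, hXv, Matrix.mulVec_smul,
        sub_self]
  choose χ hχ using hχ
  have hinj := smul_left_injective k hv0
  let f : G →* k :=
    { toFun := χ
      map_one' := hinj (by simp [← hχ])
      map_mul' := fun g h => hinj (by
        simp only [← hχ, map_mul, coe_mul]
        rw [← Matrix.mulVec_mulVec, hχ h, Matrix.mulVec_smul, hχ g, smul_smul, mul_comm]) }
  refine isCyclic_of_injective_ringHom f ((injective_iff_map_eq_one f).2 fun g hg => ?_)
  refine eq_one_of_sq_eq_one_of_odd hodd (hσ ?_)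
  rw [map_pow, map_one]
  apply sq_eq_one_of_trace_eq_zero
  have hg' : χ g = 1 := hg
  have hfix : ((σ g).1 - 1).det = 0 := by
    rw [← Matrix.exists_mulVec_eq_zero_iff]
    exact ⟨v, hv0, by rw [Matrix.sub_mulVec, hχ, hg']; simp⟩
  have hdet := (σ g).det_coe
  rw [Matrix.det_fin_two] at hdet hfix
  simp at hfix
  linear_combination hdet - hfix + CharTwo.two_eq_zero (R := k)

/-- A finite group of odd order that embeds in `SL₂` over a field of characteristic two is
cyclic. -/
lemma isCyclic_of_odd_card {k G : Type*} [Field k] [CharP k 2]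
    [Group G] [Finite G] (hodd : Odd (Nat.card G)) (σ : G →* SpecialLinearGroup (Fin 2) k)
    (hσ : Function.Injective σ) : IsCyclic G := by
  have : CharP (AlgebraicClosure k) 2 := charP_of_injective_algebraMap
    (algebraMap k (AlgebraicClosure k)).injective 2
  refine isCyclic_of_odd_card_of_isAlgClosed hodd
    ((map (algebraMap k (AlgebraicClosure k))).comp σ)
    ((map_injective_of_injective (algebraMap k (AlgebraicClosure k)).injective).comp hσ)

end Matrix.SpecialLinearGroup

namespace Matrix.SpecialLinearGroup

/-- The group acts, through `σ`, transitively on the lines of `k²`: every line is the image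
of the first coordinate axis. -/
def IsLineTransitive {k G : Type*} [Field k] [Group G]
    (σ : G →* SpecialLinearGroup (Fin 2) k) : Prop :=
  ∀ v : Fin 2 → k, v ≠ 0 → ∃ g, ∃ c : k, c ≠ 0 ∧ (σ g).1.col 0 = c • v

lemma mulVec_single_zero {k : Type*} [CommRing k] (A : Matrix (Fin 2) (Fin 2) k) :
    A.mulVec ![1, 0] = A.col 0 := by
  ext i
  simp [Matrix.mulVec, dotProduct, Fin.sum_univ_two]

lemma inv_mulVec {k : Type*} [CommRing k] {A : SpecialLinearGroup (Fin 2) k} {v w : Fin 2 → k}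
    (h : A.1.mulVec v = w) : (A⁻¹).1.mulVec w = v := by
  rw [← h, Matrix.mulVec_mulVec, ← coe_mul, inv_mul_cancel, coe_one, Matrix.one_mulVec]

lemma col_zero_eq_smul {k : Type*} [CommRing k] {A : SpecialLinearGroup (Fin 2) k}
    (h : A 1 0 = 0) : A.1.mulVec ![1, 0] = A 0 0 • ![1, 0] := by
  rw [mulVec_single_zero]
  ext i
  fin_cases i
  · simp
  · simpa using h

lemma IsLineTransitive.exists_mulVec {k G : Type*} [Field k] [Group G]
    {σ : G →* SpecialLinearGroup (Fin 2) k} (htr : IsLineTransitive σ) {v : Fin 2 → k}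
    (hv : v ≠ 0) : ∃ g, ∃ c : k, c ≠ 0 ∧ (σ g).1.mulVec ![1, 0] = c • v := by
  simpa only [mulVec_single_zero] using htr v hv

lemma IsLineTransitive.not_forall_mulVec_eq_smul {k G : Type*} [Field k] [Group G]
    {σ : G →* SpecialLinearGroup (Fin 2) k} (htr : IsLineTransitive σ) {v : Fin 2 → k}
    (hv : v ≠ 0) : ¬ ∀ g, ∃ c : k, (σ g).1.mulVec v = c • v := by
  intro hfix
  obtain ⟨g, c, hc, hg⟩ := htr.exists_mulVec hv
  have he : ∀ w : Fin 2 → k, w ≠ 0 → ∃ d : k, w = d • v := by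
    intro w hw
    obtain ⟨h, d, hd, hh⟩ := htr.exists_mulVec hw
    obtain ⟨b, hb⟩ := hfix (h * g⁻¹)
    have : (σ (h * g⁻¹)).1.mulVec (c • v) = d • w := by
      rw [← hg, Matrix.mulVec_mulVec, ← coe_mul, ← map_mul, inv_mul_cancel_right, hh]
    rw [Matrix.mulVec_smul, hb] at this
    refine ⟨d⁻¹ * (c * b), ?_⟩
    rw [← inv_smul_smul₀ hd w, ← this, smul_smul, smul_smul, mul_assoc]
  obtain ⟨d, hd⟩ := he ![1, 0] (fun h => by simpa using congrFun h 0)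
  obtain ⟨b, hb⟩ := he ![0, 1] (fun h => by simpa using congrFun h 1)
  have h0 := congrFun hd 0
  have h1 := congrFun hd 1
  have h2 := congrFun hb 0
  have h3 := congrFun hb 1
  simp at h0 h1 h2 h3
  rcases h1 with rfl | h1
  · simp at h0
  · simp [h1] at h3

/-- A line-transitive finite group in characteristic two has odd order if the stabilizer of the first
coordinate axis contains no involution. -/
lemma odd_card_of_isLineTransitive {k G : Type*} [Field k] [CharP k 2] [Group G] [Finite G]
    {σ : G →* SpecialLinearGroup (Fin 2) k} (htr : IsLineTransitive σ)
    (hinv : ∀ g, σ g 1 0 = 0 → g ^ 2 = 1 → g = 1) : Odd (Nat.card G) := by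
  by_contra hodd
  rw [Nat.not_odd_iff_even] at hodd
  obtain ⟨t, ht⟩ := exists_prime_orderOf_dvd_card' 2 hodd.two_dvd
  have ht2 : t ^ 2 = 1 := by rw [← ht, pow_orderOf_eq_one]
  have htr0 := trace_eq_zero_of_sq_eq_one (g := σ t) (by rw [← map_pow, ht2, map_one])
  have hdet : ((σ t).1 - 1).det = 0 := by
    have hd := (σ t).det_coe
    rw [Matrix.det_fin_two] at hd ⊢
    simp
    linear_combination hd - htr0 + CharTwo.two_eq_zero (R := k)
  obtain ⟨v, hv, htv⟩ := Matrix.exists_mulVec_eq_zero_iff.2 hdet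
  rw [Matrix.sub_mulVec, Matrix.one_mulVec, sub_eq_zero] at htv
  obtain ⟨g, c, hc, hg⟩ := htr.exists_mulVec hv
  have hfix : (σ (g⁻¹ * t * g)).1.mulVec ![1, 0] = ![1, 0] := by
    rw [map_mul, map_mul, coe_mul, coe_mul, ← Matrix.mulVec_mulVec, hg, ← Matrix.mulVec_mulVec,
      Matrix.mulVec_smul, htv, map_inv]
    exact inv_mulVec hg
  have h1 := hinv (g⁻¹ * t * g) (by
    rw [mulVec_single_zero] at hfix
    simpa using congrFun hfix 1) (by
    have : g⁻¹ * t * g = MulAut.conj g⁻¹ t := by simp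
    rw [this, ← map_pow, ht2, map_one])
  have : t = 1 := by
    have : t = g * (g⁻¹ * t * g) * g⁻¹ := by group
    rw [this, h1]
    simp
  simp [this] at ht

/-- The stabilizer of the first coordinate axis in a faithful line-transitive abelian group in
characteristic two is trivial. -/
lemma eq_one_of_isLineTransitive {k G : Type*} [Field k] [CharP k 2] [Group G] [IsMulCommutative G]
    {σ : G →* SpecialLinearGroup (Fin 2) k} (hσ : Function.Injective σ)
    (htr : IsLineTransitive σ) {g : G} (hg : σ g 1 0 = 0) : g = 1 := by
  have hcol := col_zero_eq_smul hg
  have key : ∀ v : Fin 2 → k, (σ g).1.mulVec v = σ g 0 0 • v := by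
    intro v
    by_cases hv : v = 0
    · simp [hv]
    obtain ⟨h, c, hc, hh⟩ := htr.exists_mulVec hv
    have : (σ g).1.mulVec (c • v) = σ g 0 0 • c • v := by
      rw [← hh, Matrix.mulVec_mulVec, ← coe_mul, ← map_mul, mul_comm' g h, map_mul, coe_mul,
        ← Matrix.mulVec_mulVec, hcol, Matrix.mulVec_smul]
    rw [Matrix.mulVec_smul, smul_comm] at this
    exact smul_right_injective _ hc this
  have h1 := key ![0, 1]
  have h01 : σ g 0 1 = 0 := by
    simpa [Matrix.mulVec, dotProduct, Fin.sum_univ_two] using congrFun h1 0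
  have h11 : σ g 1 1 = σ g 0 0 := by
    simpa [Matrix.mulVec, dotProduct, Fin.sum_univ_two] using congrFun h1 1
  have hdet := (σ g).det_coe
  rw [Matrix.det_fin_two, hg, h11] at hdet
  have h00 : σ g 0 0 = 1 := by
    have : (σ g 0 0 - 1) ^ 2 = 0 := by
      linear_combination hdet + (1 - σ g 0 0) * CharTwo.two_eq_zero (R := k)
    exact sub_eq_zero.1 (pow_eq_zero_iff two_ne_zero |>.1 this)
  apply hσ
  rw [map_one]
  ext i j
  fin_cases i <;> fin_cases j <;> simp [hg, h01, h11, h00]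

lemma card_of_isLineTransitive {k G : Type*} [Field k] [Finite k] [Group G]
    {σ : G →* SpecialLinearGroup (Fin 2) k} (htr : IsLineTransitive σ)
    (hstab : ∀ g, σ g 1 0 = 0 → g = 1) : Nat.card G = Nat.card k + 1 := by
  have he : (![1, 0] : Fin 2 → k) ≠ 0 := fun h => by simpa using congrFun h 0
  have hne : ∀ g, (σ g).1.mulVec ![1, 0] ≠ 0 := fun g h => by
    have := inv_mulVec h
    rw [Matrix.mulVec_zero] at this
    exact he this.symm
  rw [← Projectivization.card_of_finrank_two k (Fin 2 → k) (by simp)]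
  refine Nat.card_congr (Equiv.ofBijective
    (fun g => Projectivization.mk k ((σ g).1.mulVec ![1, 0]) (hne g)) ⟨fun g h hgh => ?_, ?_⟩)
  · obtain ⟨a, ha⟩ := (Projectivization.mk_eq_mk_iff' ..).1 hgh
    have h1 : (σ (h⁻¹ * g)).1.mulVec ![1, 0] = a • ![1, 0] := by
      rw [map_mul, coe_mul, ← Matrix.mulVec_mulVec, ← ha, Matrix.mulVec_smul, map_inv,
        inv_mulVec rfl]
    have := hstab (h⁻¹ * g) (by
      rw [mulVec_single_zero] at h1
      simpa using congrFun h1 1)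
    exact (inv_mul_eq_one.1 this).symm
  · intro p
    obtain ⟨g, c, hc, hg⟩ := htr.exists_mulVec p.rep_nonzero
    refine ⟨g, ?_⟩
    rw [← p.mk_rep]
    exact (Projectivization.mk_eq_mk_iff' ..).2 ⟨c, hg.symm⟩

end Matrix.SpecialLinearGroup

namespace Matrix.SpecialLinearGroup

open PowerSeries

/-- Reduction of `SL₂(F⟦X⟧)` modulo `X`. -/
noncomputable def reduction (F : Type*) [Field F] :
    SpecialLinearGroup (Fin 2) F⟦X⟧ →* SpecialLinearGroup (Fin 2) F :=
  map (constantCoeff (R := F))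

/-- The principal congruence condition `g ≡ 1` modulo `X ^ j`. -/
def IsCongruentOne {F : Type*} [Field F] (g : SpecialLinearGroup (Fin 2) F⟦X⟧) (j : ℕ) : Prop :=
  ∃ n : Matrix (Fin 2) (Fin 2) F⟦X⟧, g.1 = 1 + (X ^ j : F⟦X⟧) • n

lemma exists_eq_X_smul {F : Type*} [Field F] {n : Matrix (Fin 2) (Fin 2) F⟦X⟧}
    (hn : (constantCoeff (R := F)).mapMatrix n = 0) :
    ∃ m : Matrix (Fin 2) (Fin 2) F⟦X⟧, n = (X : F⟦X⟧) • m := by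
  have : ∀ i j, ∃ m, n i j = X * m := fun i j =>
    PowerSeries.X_dvd_iff.2 (congrFun (congrFun hn i) j)
  choose m hm using this
  exact ⟨Matrix.of m, by ext1 i j; simp [hm]⟩

lemma IsCongruentOne.of_reduction_eq_one {F : Type*} [Field F]
    {g : SpecialLinearGroup (Fin 2) F⟦X⟧} (hg : reduction F g = 1) : IsCongruentOne g 1 := by
  have h : (constantCoeff (R := F)).mapMatrix (g.1 - 1) = 0 := by
    have : (constantCoeff (R := F)).mapMatrix g.1 = 1 := congrArg Subtype.val hg
    rw [map_sub, this, map_one, sub_self]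
  obtain ⟨m, hm⟩ := exists_eq_X_smul h
  exact ⟨m, by rw [pow_one, ← hm, add_sub_cancel]⟩

lemma IsCongruentOne.bddAbove {F : Type*} [Field F]
    {g : SpecialLinearGroup (Fin 2) F⟦X⟧} (hg : g ≠ 1) :
    BddAbove {j | IsCongruentOne g j} := by
  have : ∃ i j, (g.1 - 1) i j ≠ 0 := by
    by_contra! h
    exact hg (Subtype.ext (sub_eq_zero.1 (by ext1 i j; exact h i j)))
  obtain ⟨i, j, hij⟩ := this
  obtain ⟨l, hl⟩ : ∃ l, coeff l ((g.1 - 1) i j) ≠ 0 := by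
    by_contra! h
    exact hij (by ext l; simpa using h l)
  refine ⟨l, fun e he => ?_⟩
  obtain ⟨n, hn⟩ := he
  by_contra! hle
  apply hl
  rw [hn, add_sub_cancel_left]
  exact PowerSeries.X_pow_dvd_iff.1 ⟨n i j, rfl⟩ l hle

/-- A nontrivial nilpotent `2 × 2` matrix that commutes with a conjugate of itself has the same
kernel as that conjugate. -/
lemma exists_mulVec_eq_smul_of_commute_conj {k : Type*} [Field k]
    {n : Matrix (Fin 2) (Fin 2) k} (hn : n ≠ 0) (hn2 : n * n = 0)
    (a : SpecialLinearGroup (Fin 2) k)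
    (hcomm : a.1 * n * (a⁻¹).1 * n = n * (a.1 * n * (a⁻¹).1))
    {v : Fin 2 → k} (hv : v ≠ 0) (hnv : n.mulVec v = 0) :
    ∃ c : k, a.1.mulVec v = c • v := by
  have hinv : (a⁻¹).1 * a.1 = 1 := by rw [← coe_mul, inv_mul_cancel, coe_one]
  have hainj : ∀ w, a.1.mulVec w = 0 → w = 0 := fun w hw => by
    simpa using (inv_mulVec hw).symm
  refine exists_smul_eq_of_mulVec_eq_zero hn hv hnv ?_
  by_contra hw
  obtain ⟨c, hc⟩ := exists_smul_eq_of_mulVec_eq_zero hn hv hnv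
    (w := n.mulVec (a.1.mulVec v)) (by rw [Matrix.mulVec_mulVec, hn2, Matrix.zero_mulVec])
  have hc0 : c ≠ 0 := by
    rintro rfl
    rw [zero_smul] at hc
    exact hw hc
  have h1 : a.1.mulVec (n.mulVec ((a⁻¹).1.mulVec (c • v))) = 0 := by
    rw [← hc]
    simp only [Matrix.mulVec_mulVec, ← Matrix.mul_assoc]
    rw [hcomm, Matrix.mul_assoc, Matrix.mul_assoc, Matrix.mul_assoc, hinv, Matrix.mul_one,
      ← Matrix.mulVec_mulVec, ← Matrix.mulVec_mulVec, hnv]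
    simp
  have h2 := hainj _ h1
  rw [Matrix.mulVec_smul, Matrix.mulVec_smul, smul_eq_zero_iff_right hc0] at h2
  obtain ⟨d, hd⟩ := exists_smul_eq_of_mulVec_eq_zero hn hv hnv h2
  have h3 : v = d • a.1.mulVec v := by
    rw [← Matrix.mulVec_smul, ← hd, Matrix.mulVec_mulVec, ← coe_mul, mul_inv_cancel, coe_one,
      Matrix.one_mulVec]
  have hd0 : d ≠ 0 := by
    rintro rfl
    rw [zero_smul] at h3
    exact hv h3
  apply hw
  rw [h3, Matrix.mulVec_smul, smul_eq_zero_iff_right hd0] at hnv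
  exact hnv

/-- A finite subgroup of `SL₂(F⟦X⟧)`, with `F` of characteristic two, that is transitive on the
lines of the residual plane meets the first congruence subgroup trivially. -/
lemma eq_one_of_reduction_eq_one {F : Type*} [Field F] [CharP F 2]
    {H : Subgroup (SpecialLinearGroup (Fin 2) F⟦X⟧)} [Finite H]
    (htr : IsLineTransitive ((reduction F).comp H.subtype))
    {h : SpecialLinearGroup (Fin 2) F⟦X⟧} (hH : h ∈ H) (hred : reduction F h = 1) : h = 1 := by
  by_contra hne
  have h2 : (2 : F⟦X⟧) = 0 := by
    rw [← map_ofNat (C (R := F)) 2, CharTwo.two_eq_zero, map_zero]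
  let S : Set ℕ := {j | ∃ g ∈ H, g ≠ 1 ∧ IsCongruentOne g j}
  have hS1 : 1 ∈ S := ⟨h, hH, hne, .of_reduction_eq_one hred⟩
  have hSb : BddAbove S := by
    have hS : S = ⋃ g ∈ {g | g ∈ H ∧ g ≠ 1}, {j | IsCongruentOne g j} := by
      ext j
      simp [S, and_assoc]
    rw [hS, Set.Finite.bddAbove_biUnion ((Set.toFinite (H : Set _)).subset fun g hg => hg.1)]
    exact fun g hg => IsCongruentOne.bddAbove hg.2
  obtain ⟨t, htH, ht1, n, hn⟩ := Nat.sSup_mem ⟨1, hS1⟩ hSb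
  have hmax : ∀ g ∈ H, ∀ e, sSup S < e → IsCongruentOne g e → g = 1 := fun g hg e he hc => by
    by_contra hg1
    exact absurd (le_csSup hSb ⟨g, hg, hg1, hc⟩) (not_le.2 he)
  have hpos : 1 ≤ sSup S := le_csSup hSb hS1
  generalize sSup S = j at hn hmax hpos
  have hX : (X : F⟦X⟧) ^ (j + j) ≠ 0 := pow_ne_zero _ PowerSeries.X_ne_zero
  have hn0 : (constantCoeff (R := F)).mapMatrix n ≠ 0 := by
    intro h0
    obtain ⟨m, rfl⟩ := exists_eq_X_smul h0
    exact ht1 (hmax t htH (j + 1) (Nat.lt_succ_self j) ⟨m, by rw [hn, smul_smul, pow_succ]⟩)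
  have hsq : (t ^ 2).1 = 1 + (X ^ (j + j) : F⟦X⟧) • (n * n) := by
    rw [pow_two, coe_mul, hn]
    have : (X ^ j : F⟦X⟧) • n + (X ^ j : F⟦X⟧) • n = 0 := by
      rw [← two_smul F⟦X⟧, h2, zero_smul]
    rw [add_mul, mul_add, mul_add, one_mul, mul_one, one_mul, Matrix.smul_mul, Matrix.mul_smul,
      smul_smul, ← pow_add, ← add_assoc, add_assoc 1, this, add_zero]
  have hnn : n * n = 0 := by
    have h1 := hmax _ (H.pow_mem htH 2) (j + j) (by omega) ⟨_, hsq⟩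
    rw [h1, coe_one] at hsq
    exact (smul_eq_zero_iff_right hX).1 (left_eq_add.1 hsq)
  obtain ⟨v, hv, hnv⟩ : ∃ v ≠ 0, ((constantCoeff (R := F)).mapMatrix n).mulVec v = 0 := by
    rw [Matrix.exists_mulVec_eq_zero_iff]
    have : ((constantCoeff (R := F)).mapMatrix n * (constantCoeff (R := F)).mapMatrix n).det = 0 := by
      rw [← map_mul, hnn, map_zero, Matrix.det_zero]
    rw [Matrix.det_mul] at this
    exact mul_self_eq_zero.1 this
  refine htr.not_forall_mulVec_eq_smul hv fun a => ?_
  refine exists_mulVec_eq_smul_of_commute_conj hn0 ?_ _ ?_ hv hnv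
  · rw [← map_mul, hnn, map_zero]
  obtain ⟨a, ha⟩ := a
  have hs : (a * t * a⁻¹).1 = 1 + (X ^ j : F⟦X⟧) • (a.1 * n * (a⁻¹).1) := by
    rw [coe_mul, coe_mul, hn, mul_add, add_mul, mul_one, ← coe_mul, mul_inv_cancel, coe_one,
      Matrix.mul_smul, Matrix.smul_mul]
  have hsH : a * t * a⁻¹ ∈ H := H.mul_mem (H.mul_mem ha htH) (H.inv_mem ha)
  set s := a * t * a⁻¹ with hsdef
  set m := a.1 * n * (a⁻¹).1 with hmdef
  have hcomm : (s * t).1 = (t * s).1 + (X ^ (j + j) : F⟦X⟧) • (m * n - n * m) := by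
    rw [coe_mul s t, coe_mul t s, hs, hn]
    simp only [add_mul, mul_add, one_mul, mul_one, Matrix.smul_mul, Matrix.mul_smul, smul_smul,
      ← pow_add, smul_sub]
    abel
  have hst : s * t * (t * s)⁻¹ = 1 := by
    refine hmax _ (H.mul_mem (H.mul_mem hsH htH) (H.inv_mem (H.mul_mem htH hsH))) (j + j)
      (by omega) ⟨(m * n - n * m) * ((t * s)⁻¹).1, ?_⟩
    rw [coe_mul (s * t), hcomm, add_mul, ← coe_mul, mul_inv_cancel, coe_one, Matrix.smul_mul]
  rw [mul_inv_eq_one] at hst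
  rw [hst] at hcomm
  have hmn : m * n = n * m :=
    sub_eq_zero.1 ((smul_eq_zero_iff_right hX).1 (left_eq_add.1 hcomm))
  have := congrArg (fun M : Matrix (Fin 2) (Fin 2) F⟦X⟧ => (constantCoeff (R := F)).mapMatrix M) hmn
  simp only [hmdef, map_mul] at this
  rw [← map_inv]
  exact this

lemma card_isCyclic_of_isLineTransitive {F : Type*} [Field F] [Finite F] [CharP F 2]
    {H : Subgroup (SpecialLinearGroup (Fin 2) F⟦X⟧)} [Finite H]
    (htr : IsLineTransitive ((reduction F).comp H.subtype))
    (hinv : ∀ t ∈ H, reduction F t 1 0 = 0 → t ^ 2 = 1 → t = 1) :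
    IsCyclic H ∧ Nat.card H = Nat.card F + 1 ∧ ∀ t ∈ H, reduction F t 1 0 = 0 → t = 1 := by
  have hinj : Function.Injective ((reduction F).comp H.subtype) :=
    (injective_iff_map_eq_one _).2 fun t ht =>
      Subtype.ext (eq_one_of_reduction_eq_one htr t.2 ht)
  have hodd := odd_card_of_isLineTransitive htr fun t ht ht2 =>
    Subtype.ext (hinv t t.2 ht (congrArg Subtype.val ht2))
  have hcyc := isCyclic_of_odd_card hodd _ hinj
  have hstab := fun t => eq_one_of_isLineTransitive hinj htr (g := t)
  exact ⟨hcyc, card_of_isLineTransitive htr hstab, fun t ht h =>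
    congrArg Subtype.val (hstab ⟨t, ht⟩ h)⟩

lemma exists_col_zero_eq {k : Type*} [Field k] {v : Fin 2 → k} (hv : v ≠ 0) :
    ∃ A : SpecialLinearGroup (Fin 2) k, A.1.col 0 = v := by
  by_cases h0 : v 0 = 0
  · have h1 : v 1 ≠ 0 := fun h1 => hv (by ext i; fin_cases i <;> simp [h0, h1])
    refine ⟨⟨!![v 0, -(v 1)⁻¹; v 1, 0], by simp [Matrix.det_fin_two, h1]⟩, ?_⟩
    ext i
    fin_cases i <;> simp
  · refine ⟨⟨!![v 0, 0; v 1, (v 0)⁻¹], by simp [Matrix.det_fin_two, h0]⟩, ?_⟩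
    ext i
    fin_cases i <;> simp

lemma isLineTransitive_of_cover {F : Type*} [Field F]
    {H : Subgroup (SpecialLinearGroup (Fin 2) F⟦X⟧)}
    (hcov : ∀ h, ∃ x ∈ H, reduction F (x⁻¹ * h) 1 0 = 0) :
    IsLineTransitive ((reduction F).comp H.subtype) := by
  intro v hv
  obtain ⟨A, rfl⟩ := exists_col_zero_eq hv
  obtain ⟨x, hx, hb⟩ := hcov (map (C (R := F)) A)
  have hA : reduction F (map (C (R := F)) A) = A := by
    ext i j
    simp [reduction]
  rw [map_mul, map_inv, hA] at hb
  set b := (reduction F x)⁻¹ * A with hbdef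
  have hxb : (reduction F x * b).1 = A.1 := by rw [hbdef, mul_inv_cancel_left]
  have hcol : A.1.col 0 = b 0 0 • (reduction F x).1.col 0 := by
    rw [← mulVec_single_zero, ← hxb, coe_mul, ← Matrix.mulVec_mulVec, col_zero_eq_smul hb,
      Matrix.mulVec_smul, mulVec_single_zero]
  have hb0 : b 0 0 ≠ 0 := fun h => hv (by rw [hcol, h, zero_smul])
  exact ⟨⟨x, hx⟩, (b 0 0)⁻¹, inv_ne_zero hb0, by rw [hcol, inv_smul_smul₀ hb0]; rfl⟩

lemma isLineTransitive_comap {F L : Type*} [Field F] [Group L]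
    {φ : SpecialLinearGroup (Fin 2) F⟦X⟧ →* L} {A : Subgroup L} (hA : A ≤ φ.range) {Q : Set L}
    (hQ : ∀ h, φ h ∈ Q → reduction F h 1 0 = 0) (hcov : ∀ h, ∃ x ∈ A, ∃ b ∈ Q, φ h = x * b) :
    IsLineTransitive ((reduction F).comp (A.comap φ).subtype) := by
  refine isLineTransitive_of_cover fun h => ?_
  obtain ⟨x, hx, b, hb, hxb⟩ := hcov h
  obtain ⟨y, rfl⟩ := hA hx
  refine ⟨y, hx, hQ _ ?_⟩
  rwa [map_mul, map_inv, hxb, inv_mul_cancel_left]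

/-- The embedding of `SL₂(F⟦X⟧)` in `SL₂(F((X)))`, with image the parahoric subgroup `P₁`. -/
noncomputable def parahoricOneHom (F : Type*) [Field F] :
    SpecialLinearGroup (Fin 2) F⟦X⟧ →* SpecialLinearGroup (Fin 2) (LaurentSeries F) :=
  map (HahnSeries.ofPowerSeries ℤ F)

lemma _root_.laurentVar_ne_zero (F : Type*) [Field F] : laurentVar F ≠ 0 := fun h =>
  PowerSeries.X_ne_zero (HahnSeries.ofPowerSeries_injective (h.trans (map_zero _).symm))

/-- The conjugate of a matrix over `F⟦X⟧` by the antidiagonal matrix with entries `1` and `X`. -/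
noncomputable def parahoricTwoMatrix {F : Type*} [Field F] (M : Matrix (Fin 2) (Fin 2) F⟦X⟧) :
    Matrix (Fin 2) (Fin 2) (LaurentSeries F) :=
  !![HahnSeries.ofPowerSeries ℤ F (M 1 1), HahnSeries.ofPowerSeries ℤ F (M 1 0) / laurentVar F;
    laurentVar F * HahnSeries.ofPowerSeries ℤ F (M 0 1), HahnSeries.ofPowerSeries ℤ F (M 0 0)]

lemma parahoricTwoMatrix_one {F : Type*} [Field F] :
    parahoricTwoMatrix (1 : Matrix (Fin 2) (Fin 2) F⟦X⟧) = 1 := by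
  ext1 i j
  fin_cases i <;> fin_cases j <;> simp [parahoricTwoMatrix]

lemma parahoricTwoMatrix_mul {F : Type*} [Field F] (M N : Matrix (Fin 2) (Fin 2) F⟦X⟧) :
    parahoricTwoMatrix (M * N) = parahoricTwoMatrix M * parahoricTwoMatrix N := by
  have hu := laurentVar_ne_zero F
  ext1 i j
  fin_cases i <;> fin_cases j <;>
    simp only [parahoricTwoMatrix, Matrix.mul_apply, Fin.sum_univ_two, map_add, map_mul,
      Matrix.of_apply, Matrix.cons_val', Matrix.cons_val_zero, Matrix.cons_val_one,
      Matrix.cons_val_fin_one, Fin.zero_eta, Fin.mk_one] <;>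
    field_simp <;> ring

/-- The embedding of `SL₂(F⟦X⟧)` in `SL₂(F((X)))` given by conjugation by the antidiagonal matrix
with entries `1` and `X`, with image the parahoric subgroup `P₂`. -/
noncomputable def parahoricTwoHom (F : Type*) [Field F] :
    SpecialLinearGroup (Fin 2) F⟦X⟧ →* SpecialLinearGroup (Fin 2) (LaurentSeries F) where
  toFun h := ⟨parahoricTwoMatrix h.1, by
    have hdet := h.det_coe
    rw [Matrix.det_fin_two] at hdet
    have := congrArg (HahnSeries.ofPowerSeries ℤ F) hdet
    simp only [map_sub, map_mul, map_one] at this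
    rw [parahoricTwoMatrix, Matrix.det_fin_two_of, ← mul_assoc,
      div_mul_cancel₀ _ (laurentVar_ne_zero F), ← this]
    ring⟩
  map_one' := Subtype.ext parahoricTwoMatrix_one
  map_mul' g h := Subtype.ext (parahoricTwoMatrix_mul g.1 h.1)

lemma parahoricOneHom_injective (F : Type*) [Field F] :
    Function.Injective (parahoricOneHom F) :=
  map_injective_of_injective HahnSeries.ofPowerSeries_injective

lemma parahoricTwoHom_injective (F : Type*) [Field F] :
    Function.Injective (parahoricTwoHom F) := by
  have hu := laurentVar_ne_zero F
  have hι : Function.Injective (HahnSeries.ofPowerSeries ℤ F) :=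
    HahnSeries.ofPowerSeries_injective
  intro g h hgh
  have key := fun i j => congrFun (congrFun (congrArg Subtype.val hgh) i) j
  have h11 : g 1 1 = h 1 1 := hι (key 0 0)
  have h10 : g 1 0 = h 1 0 := hι ((div_left_inj' hu).1 (key 0 1))
  have h01 : g 0 1 = h 0 1 := hι (mul_left_cancel₀ hu (key 1 0))
  have h00 : g 0 0 = h 0 0 := hι (key 1 1)
  ext1 i j
  fin_cases i <;> fin_cases j
  exacts [h00, h01, h10, h11]

lemma mem_range_parahoricOneHom {F : Type*} [Field F]
    {g : SpecialLinearGroup (Fin 2) (LaurentSeries F)} (hg : g ∈ parahoricOne F) :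
    g ∈ (parahoricOneHom F).range := by
  choose m hm using hg
  have hm' : (HahnSeries.ofPowerSeries ℤ F).mapMatrix (Matrix.of m) = g.1 := by
    ext1 i j
    exact hm i j
  refine ⟨⟨Matrix.of m, ?_⟩, Subtype.ext hm'⟩
  apply HahnSeries.ofPowerSeries_injective (Γ := ℤ)
  rw [RingHom.map_det, hm', map_one, g.det_coe]

lemma mem_range_parahoricTwoHom {F : Type*} [Field F]
    {g : SpecialLinearGroup (Fin 2) (LaurentSeries F)} (hg : g ∈ parahoricTwo F) :
    g ∈ (parahoricTwoHom F).range := by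
  have hu := laurentVar_ne_zero F
  obtain ⟨⟨x, hx⟩, ⟨w, hw⟩, ⟨y, hy⟩, _, ⟨z, rfl⟩, hz⟩ := hg
  refine ⟨⟨!![w, z; y, x], ?_⟩, ?_⟩
  · apply HahnSeries.ofPowerSeries_injective (Γ := ℤ)
    have hdet := g.det_coe
    rw [Matrix.det_fin_two] at hdet
    rw [Matrix.det_fin_two_of, map_sub, map_mul, map_mul, hx, hw, hy, map_one]
    linear_combination hdet + g 0 1 * hz
  · ext1 i j
    fin_cases i <;> fin_cases j
    · exact hx
    · exact (congrArg (· / laurentVar F) hy).trans (mul_div_cancel_left₀ _ hu)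
    · exact hz.symm
    · exact hw

lemma laurentVar_mul_mem_iff {F : Type*} [Field F] {f : F⟦X⟧} :
    (∃ y ∈ laurentIntegers F, HahnSeries.ofPowerSeries ℤ F f = laurentVar F * y) ↔
      constantCoeff f = 0 := by
  rw [← PowerSeries.X_dvd_iff]
  constructor
  · rintro ⟨_, ⟨y, rfl⟩, h⟩
    exact ⟨y, HahnSeries.ofPowerSeries_injective (h.trans (map_mul _ _ _).symm)⟩
  · rintro ⟨y, rfl⟩
    exact ⟨_, ⟨y, rfl⟩, map_mul _ _ _⟩

lemma parahoricOneHom_mem_parahoricTwo_iff {F : Type*} [Field F]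
    {h : SpecialLinearGroup (Fin 2) F⟦X⟧} :
    parahoricOneHom F h ∈ parahoricTwo F ↔ reduction F h 1 0 = 0 := by
  refine Iff.trans ⟨fun hh => hh.2.2.2, fun hh => ⟨⟨_, rfl⟩, ⟨_, rfl⟩, ?_, hh⟩⟩
    (laurentVar_mul_mem_iff (f := h 1 0))
  exact ⟨X * h 0 1, map_mul _ _ _⟩

lemma parahoricTwoHom_mem_parahoricOne_iff {F : Type*} [Field F]
    {h : SpecialLinearGroup (Fin 2) F⟦X⟧} :
    parahoricTwoHom F h ∈ parahoricOne F ↔ reduction F h 1 0 = 0 := by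
  have hu := laurentVar_ne_zero F
  refine Iff.trans ⟨fun hh => ⟨_, hh 0 1, (mul_div_cancel₀ _ hu).symm⟩, ?_⟩
    (laurentVar_mul_mem_iff (f := h 1 0))
  · rintro ⟨y, hy, hyh⟩ i j
    fin_cases i <;> fin_cases j
    · exact ⟨h 1 1, rfl⟩
    · show HahnSeries.ofPowerSeries ℤ F (h 1 0) / laurentVar F ∈ laurentIntegers F
      rwa [hyh, mul_div_cancel_left₀ _ hu]
    · exact ⟨X * h 0 1, map_mul _ _ _⟩
    · exact ⟨h 0 0, rfl⟩

lemma parahoricOneHom_mem_parahoricOne {F : Type*} [Field F]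
    (h : SpecialLinearGroup (Fin 2) F⟦X⟧) : parahoricOneHom F h ∈ parahoricOne F :=
  fun i j => ⟨h i j, rfl⟩

lemma parahoricTwoHom_mem_parahoricTwo {F : Type*} [Field F]
    (h : SpecialLinearGroup (Fin 2) F⟦X⟧) : parahoricTwoHom F h ∈ parahoricTwo F := by
  have hu := laurentVar_ne_zero F
  exact ⟨⟨h 1 1, rfl⟩, ⟨h 0 0, rfl⟩, ⟨h 1 0, (mul_div_cancel₀ _ hu).symm⟩, ⟨_, ⟨h 0 1, rfl⟩, rfl⟩⟩

/-- In an involution of the Iwahori subgroup in characteristic two, one of the two off-diagonal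
entries has valuation larger than the Iwahori condition requires. -/
lemma reduction_eq_one_or_of_sq_eq_one {F : Type*} [Field F] [CharP F 2]
    {g h : SpecialLinearGroup (Fin 2) F⟦X⟧} (hgh : parahoricOneHom F g = parahoricTwoHom F h)
    (hg : g ^ 2 = 1) : reduction F g = 1 ∨ reduction F h = 1 := by
  have hu := laurentVar_ne_zero F
  have hι : Function.Injective (HahnSeries.ofPowerSeries ℤ F) :=
    HahnSeries.ofPowerSeries_injective
  have : CharP F⟦X⟧ 2 := charP_of_injective_ringHom (f := C (R := F)) PowerSeries.C_injective 2
  have key := fun i j => congrFun (congrFun (congrArg Subtype.val hgh) i) j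
  have h11 : g 0 0 = h 1 1 := hι (key 0 0)
  have h00 : g 1 1 = h 0 0 := hι (key 1 1)
  have h01 : g 1 0 = X * h 0 1 := hι ((key 1 0).trans (map_mul _ _ _).symm)
  have h10 : h 1 0 = X * g 0 1 := by
    refine hι (Eq.trans ?_ (map_mul _ _ _).symm)
    have h' : HahnSeries.ofPowerSeries ℤ F (g 0 1) =
      HahnSeries.ofPowerSeries ℤ F (h 1 0) / laurentVar F := key 0 1
    rw [h']
    exact (mul_div_cancel₀ _ hu).symm
  have htr := trace_eq_zero_of_sq_eq_one hg
  have hdiag : g 1 1 = g 0 0 := (CharTwo.add_eq_zero.1 htr).symm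
  have hdet := g.det_coe
  rw [Matrix.det_fin_two, h01, hdiag] at hdet
  have hc0 : constantCoeff (g 0 0) = 1 := by
    have := congrArg (constantCoeff (R := F)) hdet
    simp only [map_sub, map_mul, map_one, constantCoeff_X, zero_mul, mul_zero, sub_zero] at this
    have h2 : (constantCoeff (g 0 0) - 1) ^ 2 = 0 := by
      linear_combination this + (1 - constantCoeff (g 0 0)) * CharTwo.two_eq_zero (R := F)
    exact sub_eq_zero.1 (pow_eq_zero_iff two_ne_zero |>.1 h2)
  have hprod : constantCoeff (g 0 1) * constantCoeff (h 0 1) = 0 := by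
    have h1 : g 0 0 * g 0 0 - 1 = X * (g 0 1 * h 0 1) := by linear_combination hdet
    have h2 : g 0 0 * g 0 0 - 1 = (g 0 0 - 1) * (g 0 0 - 1) := by
      linear_combination (g 0 0 - 1) * CharTwo.two_eq_zero (R := F⟦X⟧)
    obtain ⟨e, he⟩ := PowerSeries.X_dvd_iff.2
      (show constantCoeff (g 0 0 - 1) = 0 by rw [map_sub, hc0, map_one, sub_self])
    have h3 : g 0 1 * h 0 1 = X * (e * e) := by
      apply mul_left_cancel₀ (PowerSeries.X_ne_zero (R := F))
      rw [← h1, h2, he]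
      ring
    rw [← map_mul, h3, map_mul, constantCoeff_X, zero_mul]
  rcases mul_eq_zero.1 hprod with h0 | h0
  · left
    ext i j
    fin_cases i <;> fin_cases j <;> simp [reduction, h0, h01, hdiag, hc0]
  · right
    ext i j
    fin_cases i <;> fin_cases j <;> simp [reduction, h0, h10, ← h00, ← h11, hdiag, hc0]

lemma isCyclic_and_card_of_comap {M N : Type*} [Group M] [Group N] {φ : M →* N}
    (hφ : Function.Injective φ) {A : Subgroup N} (hA : A ≤ φ.range)
    (hcyc : IsCyclic (A.comap φ)) : IsCyclic A ∧ Nat.card A = Nat.card (A.comap φ) := by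
  have e := (A.comap φ).equivMapOfInjective φ hφ
  rw [Subgroup.map_comap_eq_self hA] at e
  exact ⟨e.isCyclic.1 hcyc, (Nat.card_congr e.toEquiv).symm⟩

end Matrix.SpecialLinearGroup

open Matrix.SpecialLinearGroup in
/-- Let `q = 2^a`, `K = 𝔽_q((u))`, and `P₁, P₂, B` the standard
parahoric and Iwahori subgroups of `SL₂(K)`.  If `A₁ ≤ P₁` and `A₂ ≤ P₂` are finite
subgroups with `P_i = A_i · B` and `A_i ∩ P_{3-i} = A₁ ∩ A₂` for `i = 1, 2`, then
`A₁ ∩ A₂` is trivial and each `A_i` is cyclic of order `q + 1`. -/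
theorem edge_transitive_lattice_char_two (a : ℕ) (ha : 1 ≤ a)
    (A₁ A₂ : Subgroup (Matrix.SpecialLinearGroup (Fin 2) (LaurentSeries (GaloisField 2 a))))
    (hfin₁ : Finite A₁) (hfin₂ : Finite A₂)
    (hA₁ : (↑A₁ : Set _) ⊆ parahoricOne (GaloisField 2 a))
    (hA₂ : (↑A₂ : Set _) ⊆ parahoricTwo (GaloisField 2 a))
    (hcover₁ : ∀ g ∈ parahoricOne (GaloisField 2 a),
      ∃ x ∈ A₁, ∃ b ∈ iwahori (GaloisField 2 a), g = x * b)
    (hcover₂ : ∀ g ∈ parahoricTwo (GaloisField 2 a),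
      ∃ x ∈ A₂, ∃ b ∈ iwahori (GaloisField 2 a), g = x * b)
    (hint₁ : (↑A₁ : Set _) ∩ parahoricTwo (GaloisField 2 a) = ↑(A₁ ⊓ A₂))
    (hint₂ : (↑A₂ : Set _) ∩ parahoricOne (GaloisField 2 a) = ↑(A₁ ⊓ A₂)) :
    A₁ ⊓ A₂ = ⊥ ∧
    IsCyclic A₁ ∧ Nat.card A₁ = 2 ^ a + 1 ∧
    IsCyclic A₂ ∧ Nat.card A₂ = 2 ^ a + 1 := by
  let F := GaloisField 2 a
  let φ₁ := parahoricOneHom F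
  let φ₂ := parahoricTwoHom F
  have hφ₁ : Function.Injective φ₁ := parahoricOneHom_injective F
  have hφ₂ : Function.Injective φ₂ := parahoricTwoHom_injective F
  have hr₁ : A₁ ≤ φ₁.range := fun x hx => mem_range_parahoricOneHom (hA₁ hx)
  have hr₂ : A₂ ≤ φ₂.range := fun x hx => mem_range_parahoricTwoHom (hA₂ hx)
  have htr₁ : IsLineTransitive ((reduction F).comp (A₁.comap φ₁).subtype) :=
    isLineTransitive_comap hr₁ (Q := iwahori F)
      (fun h hh => parahoricOneHom_mem_parahoricTwo_iff.1 hh.2)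
      fun h => hcover₁ _ (parahoricOneHom_mem_parahoricOne h)
  have htr₂ : IsLineTransitive ((reduction F).comp (A₂.comap φ₂).subtype) :=
    isLineTransitive_comap hr₂ (Q := iwahori F)
      (fun h hh => parahoricTwoHom_mem_parahoricOne_iff.1 hh.1)
      fun h => hcover₂ _ (parahoricTwoHom_mem_parahoricTwo h)
  have : Finite (A₁.comap φ₁) :=
    Finite.of_injective (φ₁.subgroupComap A₁) fun x y h =>
      Subtype.ext (hφ₁ (congrArg Subtype.val h))
  have : Finite (A₂.comap φ₂) :=
    Finite.of_injective (φ₂.subgroupComap A₂) fun x y h =>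
      Subtype.ext (hφ₂ (congrArg Subtype.val h))
  have hinv : ∀ x ∈ A₁ ⊓ A₂, x ^ 2 = 1 → x = 1 := by
    rintro x ⟨hx₁, hx₂⟩ hx
    obtain ⟨g, rfl⟩ := hr₁ hx₁
    obtain ⟨h, hh⟩ := hr₂ hx₂
    have hg : g ^ 2 = 1 := hφ₁ (by rw [map_pow, hx, map_one])
    rcases reduction_eq_one_or_of_sq_eq_one hh.symm hg with h1 | h1
    · rw [eq_one_of_reduction_eq_one htr₁ hx₁ h1, map_one]
    · rw [← hh, eq_one_of_reduction_eq_one htr₂ (by rwa [Subgroup.mem_comap, hh]) h1, map_one]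
  obtain ⟨hcyc₁, hcard₁, hstab₁⟩ := card_isCyclic_of_isLineTransitive htr₁ fun t ht h ht2 =>
    hφ₁ ((hinv _ (hint₁.subset ⟨ht, parahoricOneHom_mem_parahoricTwo_iff.2 h⟩)
      (by rw [← map_pow, ht2, map_one])).trans (map_one φ₁).symm)
  obtain ⟨hcyc₂, hcard₂, -⟩ := card_isCyclic_of_isLineTransitive htr₂ fun t ht h ht2 =>
    hφ₂ ((hinv _ (hint₂.subset ⟨ht, parahoricTwoHom_mem_parahoricOne_iff.2 h⟩)
      (by rw [← map_pow, ht2, map_one])).trans (map_one φ₂).symm)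
  have hF : Nat.card F = 2 ^ a := GaloisField.card 2 a (by omega)
  obtain ⟨hc₁, hn₁⟩ := isCyclic_and_card_of_comap hφ₁ hr₁ hcyc₁
  obtain ⟨hc₂, hn₂⟩ := isCyclic_and_card_of_comap hφ₂ hr₂ hcyc₂
  refine ⟨(Subgroup.eq_bot_iff_forall _).2 ?_, hc₁, by rw [hn₁, hcard₁, hF], hc₂,
    by rw [hn₂, hcard₂, hF]⟩
  rintro x ⟨hx₁, hx₂⟩
  obtain ⟨g, rfl⟩ := hr₁ hx₁
  rw [hstab₁ g hx₁ (parahoricOneHom_mem_parahoricTwo_iff.1 (hA₂ hx₂)), map_one]
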